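/- Let k** ∈ ℕ, let G be a finite graph with the non-k**-tree property, and let ε be a real with 0 < ε < 1/2^{k**}. Let ⟨m_i : i < k**⟩ be natural numbers with m_{i+1} ≤ ε·m_i for all i < k**−1, with m_{k**−1} > k** and m_0 ≥ 1/ε^{k**}. Then for every A ⊆ G with |A| = n there is a sequence ⟨A_i : i < j(*)⟩ with j(*) ≤ n/m_{k**−1} of pairwise disjoint subsets of A such that: (1) for each i < j(*) there is ℓ < k** with |A_i| = m_ℓ; (2) each A_i is ε-excellent; (3) for all i ≠ j < j(*) the pair (A_i, A_j) is (ε,ε)-uniform; and (4) |A ∖ ⋃_{i<j(*)} A_i| < m_0. -/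

import Mathlib

open Finset

open scoped Classical

namespace Paper

variable {V : Type}

/-- `G` has the `k`-order property. -/
def HasOrderProp (G : SimpleGraph V) (k : ℕ) : Prop :=
  ∃ a b : Fin k → V, ∀ i j : Fin k, i < j → G.Adj (a i) (b j) ∧ ¬ G.Adj (a j) (b i)

/-- `G` has the non-`k`-order property. -/
def NoOrderProp (G : SimpleGraph V) (k : ℕ) : Prop := ¬ HasOrderProp G k

/-- `G` has the non-`k`-tree property. -/
def NoTreeProp (G : SimpleGraph V) (k : ℕ) : Prop :=
  ¬ ∃ (a : (Fin k → Bool) → V) (b : (m : Fin k) → (Fin (m : ℕ) → Bool) → V),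
      ∀ (η : Fin k → Bool) (m : Fin k) (ρ : Fin (m : ℕ) → Bool),
        (∀ i : Fin (m : ℕ), η ⟨i.1, i.2.trans m.2⟩ = ρ i) →
        (G.Adj (a η) (b m ρ) ↔ η m = true)

/-- The truth value `t` is the `ζ`-average of the vertex `a` over the set `B`:
all but fewer than `ζ|B|` of the `b ∈ B` satisfy `(a R b) ≡ t`. -/
def AvgIs (G : SimpleGraph V) (ζ : ℝ) (B : Finset V) (a : V) (t : Bool) : Prop :=
  ((B.filter fun b => ¬ (G.Adj a b ↔ t = true)).card : ℝ) < ζ * B.card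

/-- `A` is `ε`-good. -/
def Good (G : SimpleGraph V) (ε : ℝ) (A : Finset V) : Prop :=
  ∀ b : V, ∃ t : Bool, AvgIs G ε A b t

/-- `A` is `(ε,ζ)`-excellent. -/
def Excellent (G : SimpleGraph V) (ε ζ : ℝ) (A : Finset V) : Prop :=
  Good G ε A ∧
    ∀ B : Finset V, Good G ζ B →
      ∃ t : Bool, ((A.filter fun a => ¬ AvgIs G ζ B a t).card : ℝ) < ε * A.card

/-- The pair `(A,B)` is `(ε,ζ)`-uniform. -/
def Uniform (G : SimpleGraph V) (ε ζ : ℝ) (A B : Finset V) : Prop :=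
  ∃ t : Bool, ((A.filter fun a => ¬ AvgIs G ζ B a t).card : ℝ) < ε * A.card

/-- `A` is `f`-indivisible. -/
def Indivisible (G : SimpleGraph V) (f : ℕ → ℕ) (A : Finset V) : Prop :=
  ∀ b : V, ∃ t : Bool, (A.filter fun a => ¬ (G.Adj a b ↔ t = true)).card < f A.card

/-- `A` is `ε`-indivisible, for a real `ε ∈ (0,1)`. -/
def EpsIndivisible (G : SimpleGraph V) (ε : ℝ) (A : Finset V) : Prop :=
  ∀ b : V, ∃ t : Bool,
    ((A.filter fun a => ¬ (G.Adj a b ↔ t = true)).card : ℝ) < (A.card : ℝ) ^ ε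

/-- The edge density between `A` and `B`. -/
noncomputable def density (G : SimpleGraph V) (A B : Finset V) : ℝ :=
  (((A ×ˢ B).filter fun p => G.Adj p.1 p.2).card : ℝ) / (A.card * B.card)

/-- The pair `(A,B)` is `ε`-regular. -/
def Regular (G : SimpleGraph V) (ε : ℝ) (A B : Finset V) : Prop :=
  ∀ A' ⊆ A, ∀ B' ⊆ B, ε * A.card ≤ (A'.card : ℝ) → ε * B.card ≤ (B'.card : ℝ) →
    |density G A B - density G A' B'| < ε

/-- The sequence `⟨a_i : i < n⟩` is `Δ_k`-indiscernible. -/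
def DeltaIndiscernible (G : SimpleGraph V) (k : ℕ) {n : ℕ} (a : Fin n → V) : Prop :=
  Function.Injective a ∧
  (∀ i₀ i₁ j₀ j₁ : Fin n, i₀ < i₁ → j₀ < j₁ →
    (G.Adj (a i₀) (a i₁) ↔ G.Adj (a j₀) (a j₁))) ∧
  (∀ m : ℕ, m ≤ k → ∀ i j : Fin k → Fin n, StrictMono i → StrictMono j →
    (((∃ y : V, (∀ ℓ : Fin k, (ℓ : ℕ) < m → G.Adj y (a (i ℓ))) ∧
                (∀ ℓ : Fin k, m ≤ (ℓ : ℕ) → ¬ G.Adj y (a (i ℓ)))) ↔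
      (∃ y : V, (∀ ℓ : Fin k, (ℓ : ℕ) < m → G.Adj y (a (j ℓ))) ∧
                (∀ ℓ : Fin k, m ≤ (ℓ : ℕ) → ¬ G.Adj y (a (j ℓ))))) ∧
     ((∃ y : V, (∀ ℓ : Fin k, (ℓ : ℕ) < m → ¬ G.Adj y (a (i ℓ))) ∧
                (∀ ℓ : Fin k, m ≤ (ℓ : ℕ) → G.Adj y (a (i ℓ)))) ↔
      (∃ y : V, (∀ ℓ : Fin k, (ℓ : ℕ) < m → ¬ G.Adj y (a (j ℓ))) ∧
                (∀ ℓ : Fin k, m ≤ (ℓ : ℕ) → G.Adj y (a (j ℓ)))))))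

end Paper

namespace Paper

variable {V : Type}

theorem good_singleton (G : SimpleGraph V) {ε : ℝ} (hε : 0 < ε) (b : V) : Good G ε {b} := by
  intro a
  refine ⟨decide (G.Adj a b), ?_⟩
  simp [AvgIs, Finset.filter_singleton, hε]

theorem Good.nonempty {G : SimpleGraph V} {ε : ℝ} {B : Finset V} (hB : Good G ε B) (v : V) :
    B.Nonempty := by
  obtain ⟨t, ht⟩ := hB v
  rw [Finset.nonempty_iff_ne_empty]
  rintro rfl
  simp [AvgIs] at ht

/-- A set which is not excellent is split by a good set into two large parts. -/
theorem exists_good_split {G : SimpleGraph V} {ε : ℝ} (hε : 0 < ε) {S : Finset V}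
    (hS : ¬ Excellent G ε ε S) :
    ∃ B, Good G ε B ∧ ∀ t, ε * S.card ≤ ((S.filter fun a => AvgIs G ε B a t).card : ℝ) := by
  by_cases hgood : Good G ε S
  · simp only [Excellent, hgood, true_and, not_forall, not_exists, not_lt] at hS
    obtain ⟨B, hB, h⟩ := hS
    refine ⟨B, hB, fun t => (h (!t)).trans ?_⟩
    gcongr with a
    intro ha
    obtain ⟨s, hs⟩ := hB a
    cases s <;> cases t <;> simp_all
  · simp only [Good, not_forall, not_exists, AvgIs, not_lt] at hgood
    obtain ⟨b, hb⟩ := hgood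
    refine ⟨{b}, good_singleton G hε b, fun t => (hb (!t)).trans ?_⟩
    gcongr with a
    intro ha
    have : G.Adj a b ↔ t = true := by
      rw [G.adj_comm]
      cases t <;> simp_all
    simp [AvgIs, Finset.filter_singleton, this, hε]

/-- Iterated splitting: if no subset of `S` of one of the prescribed sizes is excellent, then `S`
contains the leaves of a tree whose inner nodes are good sets. -/
theorem exists_average_tree {G : SimpleGraph V} {ε : ℝ} (hε : 0 < ε) (d : ℕ) :
    ∀ (m : ℕ → ℕ) (S : Finset V), (∀ i, i + 1 < d → (m (i + 1) : ℝ) ≤ ε * m i) →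
      (∀ i < d, 0 < m i) → S.Nonempty → (0 < d → m 0 ≤ S.card) →
      (∀ i < d, ∀ T ⊆ S, T.card = m i → ¬ Excellent G ε ε T) →
      ∃ (B : List Bool → Finset V) (a : List Bool → V), (∀ l, Good G ε (B l)) ∧
        ∀ η, η.length = d → a η ∈ S ∧
          ∀ l₁ t l₂, η = l₁ ++ t :: l₂ → AvgIs G ε (B l₁) (a η) t := by
  induction d with
  | zero =>
    rintro m S - - ⟨v, hv⟩ - -
    refine ⟨fun _ => {v}, fun _ => v, fun _ => good_singleton G hε v, fun η hη => ⟨hv, ?_⟩⟩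
    intro l₁ t l₂ h
    simp [h] at hη
  | succ d ih =>
    intro m S hdec hpos hne hcard hex
    obtain ⟨T, hTS, hT⟩ := Finset.exists_subset_card_eq (hcard d.succ_pos)
    obtain ⟨B₀, hB₀, hsplit⟩ := exists_good_split hε (hex 0 d.succ_pos T hTS hT)
    rw [hT] at hsplit
    have hm : (0 : ℝ) < m 0 := by exact_mod_cast hpos 0 d.succ_pos
    have key := fun t : Bool => ih (fun i => m (i + 1)) (T.filter fun a => AvgIs G ε B₀ a t)
      (fun i hi => hdec (i + 1) (by omega)) (fun i hi => hpos (i + 1) (by omega))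
      (by
        rw [← Finset.card_pos]
        exact_mod_cast (mul_pos hε hm).trans_le (hsplit t))
      (fun hd => by exact_mod_cast (hdec 0 (by omega)).trans (hsplit t))
      (fun i hi U hU => hex (i + 1) (by omega) U
        (hU.trans ((Finset.filter_subset _ _).trans hTS)))
    choose B a hB ha using key
    refine ⟨fun l => l.casesOn B₀ (fun t l => B t l),
      fun l => l.casesOn hne.choose (fun t l => a t l), ?_, ?_⟩
    · rintro (_ | ⟨t, l⟩)
      · exact hB₀
      · exact hB t l
    · rintro (_ | ⟨s, η⟩) hη
      · simp at hη
      · obtain ⟨hmem, havg⟩ := ha s η (by simpa using hη)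
        rw [Finset.mem_filter] at hmem
        refine ⟨hTS hmem.1, ?_⟩
        rintro (_ | ⟨r, l₁⟩) t l₂ h
        · obtain ⟨rfl, -⟩ : s = t ∧ η = l₂ := by simpa using h
          exact hmem.2
        · obtain ⟨rfl, htail⟩ : s = r ∧ η = l₁ ++ t :: l₂ := by simpa using h
          exact havg l₁ t l₂ htail

/-- A set contains an element realising the averages of few vertices simultaneously. -/
theorem exists_mem_forall_adj_iff {G : SimpleGraph V} {ε : ℝ} {ι : Type*} [Fintype ι]
    (hι : Fintype.card ι * ε < 1) {B : Finset V} (hB : B.Nonempty) (a : ι → V) (t : ι → Bool)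
    (h : ∀ i, AvgIs G ε B (a i) (t i)) : ∃ b ∈ B, ∀ i, G.Adj (a i) b ↔ t i = true := by
  by_contra! hcon
  have hsub : B ⊆ univ.biUnion fun i => B.filter fun b => ¬ (G.Adj (a i) b ↔ t i = true) := by
    intro b hb
    obtain ⟨i, hi⟩ := hcon b hb
    simp only [Finset.mem_biUnion, Finset.mem_filter]
    exact ⟨i, mem_univ i, hb, by tauto⟩
  have hle : (B.card : ℝ) ≤ Fintype.card ι * (ε * B.card) := calc
    (B.card : ℝ) ≤ ∑ i, ((B.filter fun b => ¬ (G.Adj (a i) b ↔ t i = true)).card : ℝ) := by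
      exact_mod_cast (Finset.card_le_card hsub).trans Finset.card_biUnion_le
    _ ≤ ∑ _i : ι, ε * B.card := Finset.sum_le_sum fun i _ => (h i).le
    _ = Fintype.card ι * (ε * B.card) := by simp
  have hpos : (0 : ℝ) < B.card := by exact_mod_cast hB.card_pos
  nlinarith

theorem ofFn_eq_append_cons {α : Type*} {k : ℕ} (η : Fin k → α) (m : Fin k) :
    ∃ l, List.ofFn η = List.ofFn (fun i : Fin (m : ℕ) => η ⟨i.1, i.2.trans m.2⟩) ++ η m :: l := by
  refine ⟨(List.ofFn η).drop (m + 1), ?_⟩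
  have htake : List.ofFn (fun i : Fin (m : ℕ) => η ⟨i.1, i.2.trans m.2⟩) =
      (List.ofFn η).take m := by
    apply List.ext_getElem <;> simp [m.2.le]
  have hm : (m : ℕ) < (List.ofFn η).length := by simp
  have hget : η m = (List.ofFn η)[(m : ℕ)] := by simp
  rw [htake, hget, ← List.drop_eq_getElem_cons hm, List.take_append_drop]

/-- In a graph without trees of height `k`, every large set contains an excellent subset of one of
the prescribed sizes. -/
theorem exists_excellent_subset {G : SimpleGraph V} {k : ℕ} (hG : NoTreeProp G k) {ε : ℝ}
    (hε : 0 < ε) (hεk : ε < 1 / 2 ^ k) {m : ℕ → ℕ}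
    (hdec : ∀ i, i + 1 < k → (m (i + 1) : ℝ) ≤ ε * m i) (hpos : ∀ i < k, 0 < m i)
    {S : Finset V} (hS : S.Nonempty) (hcard : m 0 ≤ S.card) :
    ∃ T ⊆ S, (∃ i < k, T.card = m i) ∧ Excellent G ε ε T := by
  by_contra! hcon
  obtain ⟨B, a, hB, ha⟩ := exists_average_tree hε k m S hdec hpos hS (fun _ => hcard)
    (fun i hi T hT hTi => hcon T hT ⟨i, hi, hTi⟩)
  have hsel : ∀ (j : Fin k) (ρ : Fin (j : ℕ) → Bool), ∃ b,
      ∀ η : {η : Fin k → Bool // ∀ i : Fin (j : ℕ), η ⟨i.1, i.2.trans j.2⟩ = ρ i},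
        G.Adj (a (List.ofFn η.1)) b ↔ η.1 j = true := by
    intro j ρ
    have hcount : (Fintype.card {η : Fin k → Bool //
        ∀ i : Fin (j : ℕ), η ⟨i.1, i.2.trans j.2⟩ = ρ i} : ℝ) * ε < 1 := by
      refine lt_of_le_of_lt ?_ ((lt_div_iff₀' (by positivity)).1 hεk)
      gcongr
      exact_mod_cast (Fintype.card_subtype_le _).trans (by simp)
    have havg : ∀ η : {η : Fin k → Bool // ∀ i : Fin (j : ℕ), η ⟨i.1, i.2.trans j.2⟩ = ρ i},
        AvgIs G ε (B (List.ofFn ρ)) (a (List.ofFn η.1)) (η.1 j) := by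
      rintro ⟨η, hη⟩
      obtain ⟨l, hl⟩ := ofFn_eq_append_cons η j
      rw [funext hη] at hl
      exact (ha _ (by simp)).2 _ _ l hl
    obtain ⟨b, -, hb⟩ :=
      exists_mem_forall_adj_iff hcount ((hB _).nonempty hS.choose) _ _ havg
    exact ⟨b, hb⟩
  choose b hb using hsel
  exact hG ⟨fun η => a (List.ofFn η), b, fun η j ρ h => hb j ρ ⟨η, h⟩⟩

/-- Greedy extraction of disjoint subsets until fewer than `N` elements remain. -/
theorem exists_pairwiseDisjoint_family {α : Type*} {p : Finset α → Prop} {N : ℕ}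
    (h : ∀ A : Finset α, N ≤ A.card → ∃ T ⊆ A, T.Nonempty ∧ p T) (A : Finset α) :
    ∃ F : Finset (Finset α), (∀ T ∈ F, T ⊆ A ∧ p T) ∧ (F : Set (Finset α)).PairwiseDisjoint id ∧
      (A.filter fun a => ∀ T ∈ F, a ∉ T).card < N := by
  induction A using Finset.strongInduction with
  | H A ih =>
    rcases lt_or_ge A.card N with hA | hA
    · exact ⟨∅, by simp, by simp, by simpa using hA⟩
    · obtain ⟨T, hTA, hT, hpT⟩ := h A hA
      obtain ⟨F, hF, hdisj, hcard⟩ := ih (A \ T) (Finset.sdiff_ssubset hTA hT)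
      refine ⟨insert T F, ?_, ?_, ?_⟩
      · intro U hU
        rcases Finset.mem_insert.1 hU with rfl | hU
        · exact ⟨hTA, hpT⟩
        · exact ⟨(hF U hU).1.trans Finset.sdiff_subset, (hF U hU).2⟩
      · rw [Finset.coe_insert]
        refine hdisj.insert fun U hU _ => ?_
        exact Finset.disjoint_sdiff.mono_right (hF U hU).1
      · refine lt_of_le_of_lt (Finset.card_le_card ?_) hcard
        intro x hx
        simp only [Finset.mem_filter, Finset.mem_insert, Finset.mem_sdiff] at hx ⊢
        exact ⟨⟨hx.1, hx.2 T (Or.inl rfl)⟩, fun U hU => hx.2 U (Or.inr hU)⟩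

end Paper

open Paper

theorem stmt9 (kss : ℕ) (V : Type) [Fintype V] (G : SimpleGraph V)
    (hG : NoTreeProp G kss) (ε : ℝ) (hε0 : 0 < ε) (hε1 : ε < 1 / 2 ^ kss)
    (m : ℕ → ℕ)
    (hdec : ∀ i : ℕ, i < kss - 1 → (m (i + 1) : ℝ) ≤ ε * m i)
    (hlast : kss < m (kss - 1))
    (hfirst : 1 / ε ^ kss ≤ (m 0 : ℝ)) :
    ∀ (A : Finset V) (n : ℕ), A.card = n →
      ∃ jstar : ℕ, (jstar : ℝ) ≤ (n : ℝ) / m (kss - 1) ∧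
        ∃ P : Fin jstar → Finset V,
          (∀ i, P i ⊆ A) ∧
          (∀ i j, i ≠ j → Disjoint (P i) (P j)) ∧
          (∀ i, ∃ ℓ < kss, (P i).card = m ℓ) ∧
          (∀ i, Excellent G ε ε (P i)) ∧
          (∀ i j, i ≠ j → Uniform G ε ε (P i) (P j)) ∧
          (A.filter fun a => ∀ i, a ∉ P i).card < m 0 := by
  have hε1' : ε ≤ 1 :=
    hε1.le.trans (div_le_one_of_le₀ (one_le_pow₀ (by norm_num)) (by positivity))
  have hanti : ∀ i < kss, m (kss - 1) ≤ m i := by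
    intro i hi
    refine Nat.decreasingInduction (motive := fun i _ => m (kss - 1) ≤ m i) ?_ le_rfl
      (show i ≤ kss - 1 by omega)
    intro j hj ih
    refine ih.trans ?_
    have := (hdec j hj).trans (mul_le_of_le_one_left (Nat.cast_nonneg _) hε1')
    exact_mod_cast this
  have hlast0 : 0 < m (kss - 1) := by omega
  have hpos : ∀ i < kss, 0 < m i := fun i hi => hlast0.trans_le (hanti i hi)
  have hm0 : 0 < m 0 := by
    have : (0 : ℝ) < m 0 := lt_of_lt_of_le (by positivity) hfirst
    exact_mod_cast this
  rintro A n rfl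
  obtain ⟨F, hF, hdisj, hrest⟩ := exists_pairwiseDisjoint_family
    (p := fun T => (∃ i < kss, T.card = m i) ∧ Excellent G ε ε T) (N := m 0)
    (fun S hS => by
      obtain ⟨T, hTS, ⟨i, hi, hTi⟩, hT⟩ := exists_excellent_subset hG hε0 hε1
        (fun i hi => hdec i (by omega)) hpos (Finset.card_pos.1 (hm0.trans_le hS)) hS
      exact ⟨T, hTS, Finset.card_pos.1 (hTi ▸ hpos i hi), ⟨i, hi, hTi⟩, hT⟩) A
  have hmem := fun i => (F.equivFin.symm i).2
  refine ⟨F.card, ?_, fun i => F.equivFin.symm i, fun i => (hF _ (hmem i)).1, ?_,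
    fun i => (hF _ (hmem i)).2.1, fun i => (hF _ (hmem i)).2.2,
    fun i j _ => (hF _ (hmem i)).2.2.2 _ (hF _ (hmem j)).2.2.1, ?_⟩
  · rw [le_div_iff₀ (by exact_mod_cast hlast0)]
    have hle : F.card * m (kss - 1) ≤ A.card := calc
      F.card * m (kss - 1) ≤ ∑ T ∈ F, T.card := by
        rw [← smul_eq_mul]
        refine Finset.card_nsmul_le_sum _ _ _ fun T hT => ?_
        obtain ⟨i, hi, hTi⟩ := (hF T hT).2.1
        exact hTi ▸ hanti i hi
      _ = (F.biUnion id).card := (Finset.card_biUnion hdisj).symm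
      _ ≤ A.card := Finset.card_le_card (Finset.biUnion_subset.2 fun T hT => (hF T hT).1)
    exact_mod_cast hle
  · intro i j hij
    refine hdisj (hmem i) (hmem j) fun h => hij ?_
    exact F.equivFin.symm.injective (Subtype.ext h)
  · refine lt_of_le_of_lt (Finset.card_le_card ?_) hrest
    intro x hx
    simp only [Finset.mem_filter] at hx ⊢
    refine ⟨hx.1, fun T hT => ?_⟩
    simpa using hx.2 (F.equivFin ⟨T, hT⟩)
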